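/- Let ψ be a flow on a metric space (X,d) such that ψ_t is Lipschitz continuous for every t ≥ 0, uniformly for t in compact subsets of [0,+∞). If every Lipschitz continuous Lyapunov function for ψ is constant, then ψ is strongly chain recurrent. -/

import Mathlib

/-- A (continuous) flow on a metric space. -/
def IsFlow {X : Type*} [MetricSpace X] (ψ : ℝ → X → X) : Prop :=
  Continuous (fun p : ℝ × X => ψ p.1 p.2) ∧ (∀ x, ψ 0 x = x) ∧
    ∀ t s x, ψ (t + s) x = ψ t (ψ s x)

/-- There is a strong `(ε,T)`-chain from `a` to `b`: a finite sequence
`(x_i, t_i)`, `i = 1, …, n` with `t_i ≥ T`, `x_1 = a`, `x_{n+1} = b`, and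
`∑ d(ψ_{t_i}(x_i), x_{i+1}) < ε`. -/
def HasStrongChain {X : Type*} [MetricSpace X] (ψ : ℝ → X → X) (ε T : ℝ) (a b : X) : Prop :=
  ∃ (n : ℕ) (x : Fin (n + 1) → X) (t : Fin n → ℝ), 0 < n ∧ (∀ i, T ≤ t i) ∧
    x 0 = a ∧ x (Fin.last n) = b ∧
    (∑ i : Fin n, dist (ψ (t i) (x i.castSucc)) (x i.succ)) < ε

/-- A strongly chain recurrent point. -/
def StronglyChainRecurrentPt {X : Type*} [MetricSpace X] (ψ : ℝ → X → X) (x : X) : Prop :=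
  ∀ ε > 0, ∀ T ≥ (0 : ℝ), HasStrongChain ψ ε T x x

/-- A Lyapunov function for the flow `ψ`. -/
def IsLyapunov {X : Type*} [MetricSpace X] (ψ : ℝ → X → X) (h : X → ℝ) : Prop :=
  ∀ t ≥ (0 : ℝ), ∀ x, h (ψ t x) ≤ h x

/-- The neutral set of a Lyapunov function. -/
def NeutralSet {X : Type*} [MetricSpace X] (ψ : ℝ → X → X) (h : X → ℝ) : Set X :=
  {x | ∀ t : ℝ, h (ψ t x) = h x}

/-- A first integral for the flow `ψ`. -/
def IsFirstIntegral {X : Type*} [MetricSpace X] (ψ : ℝ → X → X) (h : X → ℝ) : Prop :=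
  ∀ (t : ℝ) (x : X), h (ψ t x) = h x

/-- `ψ_t` is Lipschitz for every `t ≥ 0`, uniformly for `t` in compact subsets
of `[0, +∞)`. -/
def UniformlyLipschitzTimeMaps {X : Type*} [MetricSpace X] (ψ : ℝ → X → X) : Prop :=
  ∀ T ≥ (0 : ℝ), ∃ C : NNReal, ∀ t ∈ Set.Icc 0 T, LipschitzWith C (ψ t)

/-- The flow `ψ` is strongly chain transitive. -/
def StronglyChainTransitive {X : Type*} [MetricSpace X] (ψ : ℝ → X → X) : Prop :=
  ∀ x y : X, ∀ ε > 0, ∀ T ≥ (0 : ℝ), HasStrongChain ψ ε T x y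

/-- A possibly empty strong chain: like `HasStrongChain`, but the number of steps may be zero. -/
def HasWeakStrongChain {X : Type*} [MetricSpace X] (ψ : ℝ → X → X) (ε T : ℝ) (a b : X) : Prop :=
  ∃ (n : ℕ) (x : Fin (n + 1) → X) (t : Fin n → ℝ), (∀ i, T ≤ t i) ∧
    x 0 = a ∧ x (Fin.last n) = b ∧
    (∑ i : Fin n, dist (ψ (t i) (x i.castSucc)) (x i.succ)) < ε

section

variable {X : Type*} [MetricSpace X] {ψ : ℝ → X → X} {ε T : ℝ} {a b : X}

theorem HasStrongChain.weak (h : HasStrongChain ψ ε T a b) : HasWeakStrongChain ψ ε T a b := by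
  obtain ⟨n, x, t, -, h⟩ := h
  exact ⟨n, x, t, h⟩

theorem HasWeakStrongChain.mono {δ : ℝ} (h : HasWeakStrongChain ψ ε T a b) (hδ : ε ≤ δ) :
    HasWeakStrongChain ψ δ T a b := by
  obtain ⟨n, x, t, ht, ha, hb, hs⟩ := h
  exact ⟨n, x, t, ht, ha, hb, hs.trans_le hδ⟩

/-- A strong chain consists of a first step followed by a possibly empty strong chain. -/
theorem hasStrongChain_iff_step : HasStrongChain ψ ε T a b ↔
    ∃ t ≥ T, ∃ c, HasWeakStrongChain ψ (ε - dist (ψ t a) c) T c b := by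
  constructor
  · rintro ⟨n, x, t, hn, ht, rfl, rfl, hs⟩
    obtain ⟨m, rfl⟩ := Nat.exists_eq_succ_of_ne_zero hn.ne'
    refine ⟨t 0, ht 0, x (Fin.succ 0), m, fun i => x i.succ, fun i => t i.succ,
      fun i => ht _, rfl, rfl, ?_⟩
    rw [Fin.sum_univ_succ] at hs
    simp only [Fin.castSucc_zero] at hs
    simp only [← Fin.castSucc_succ] at hs ⊢
    linarith
  · rintro ⟨s, hs, c, n, x, t, ht, rfl, rfl, hsum⟩
    refine ⟨n + 1, Fin.cons a x, Fin.cons s t, n.succ_pos, ?_, by simp, ?_, ?_⟩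
    · intro i
      refine Fin.cases ?_ (fun j => ?_) i
      · simpa using hs
      · simpa using ht j
    · rw [← Fin.succ_last, Fin.cons_succ]
    · rw [Fin.sum_univ_succ]
      simp only [Fin.castSucc_zero, Fin.cons_zero, Fin.cons_succ, Fin.castSucc_succ]
      linarith

theorem HasStrongChain.pos (h : HasStrongChain ψ ε T a b) : 0 < ε := by
  obtain ⟨n, x, t, -, -, -, -, hs⟩ := h
  exact (Finset.sum_nonneg fun _ _ => dist_nonneg).trans_lt hs

theorem HasStrongChain.mono {δ : ℝ} (h : HasStrongChain ψ ε T a b) (hδ : ε ≤ δ) :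
    HasStrongChain ψ δ T a b := by
  obtain ⟨n, x, t, hn, ht, ha, hb, hs⟩ := h
  exact ⟨n, x, t, hn, ht, ha, hb, hs.trans_le hδ⟩

theorem hasStrongChain_of_dist_lt {t : ℝ} (ht : T ≤ t) (h : dist (ψ t a) b < ε) :
    HasStrongChain ψ ε T a b :=
  hasStrongChain_iff_step.2
    ⟨t, ht, b, 0, fun _ => b, Fin.elim0, fun i => i.elim0, rfl, rfl, by simpa using h⟩

theorem HasStrongChain.of_flow (hψ : IsFlow ψ) {s : ℝ} (hs : 0 ≤ s)
    (h : HasStrongChain ψ ε T (ψ s a) b) : HasStrongChain ψ ε T a b := by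
  obtain ⟨t, ht, c, hc⟩ := hasStrongChain_iff_step.1 h
  refine hasStrongChain_iff_step.2 ⟨t + s, by linarith, c, ?_⟩
  rwa [hψ.2.2]

/-- Moving the initial point of a strong chain increases its cost in a Lipschitz way: long first
steps are split so that only time maps with time in `[0, 2 * T]` act on the displacement. -/
theorem HasStrongChain.move_start (hψ : IsFlow ψ) (hT : 0 ≤ T) {C : NNReal}
    (hC : ∀ t ∈ Set.Icc 0 (2 * T), LipschitzWith C (ψ t)) (h : HasStrongChain ψ ε T a b)
    (a' : X) : HasStrongChain ψ (ε + C * dist a' a) T a' b := by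
  obtain ⟨t, ht, c, hc⟩ := hasStrongChain_iff_step.1 h
  rcases le_total t (2 * T) with h2 | h2
  · refine hasStrongChain_iff_step.2 ⟨t, ht, c, hc.mono ?_⟩
    have h1 := (hC t ⟨hT.trans ht, h2⟩).dist_le_mul a' a
    have h3 := dist_triangle (ψ t a') (ψ t a) c
    linarith
  · have htail : HasStrongChain ψ ε T (ψ T a) b := by
      refine hasStrongChain_iff_step.2 ⟨t - T, by linarith, c, ?_⟩
      rwa [← hψ.2.2, sub_add_cancel]
    refine hasStrongChain_iff_step.2 ⟨T, le_rfl, ψ T a, htail.weak.mono ?_⟩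
    have h1 := (hC T ⟨hT, by linarith⟩).dist_le_mul a' a
    linarith

end

/-- The infimum of the costs of the strong chains from `a` to `b` with times at least `T`. -/
noncomputable def strongChainCost {X : Type*} [MetricSpace X] (ψ : ℝ → X → X) (T : ℝ)
    (a b : X) : ℝ :=
  sInf {ε | HasStrongChain ψ ε T a b}

section

variable {X : Type*} [MetricSpace X] {ψ : ℝ → X → X} {ε T : ℝ} {a b : X}

theorem nonempty_setOf_hasStrongChain (ψ : ℝ → X → X) (T : ℝ) (a b : X) :
    {ε | HasStrongChain ψ ε T a b}.Nonempty :=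
  ⟨dist (ψ T a) b + 1, hasStrongChain_of_dist_lt le_rfl (lt_add_one _)⟩

theorem strongChainCost_le (h : HasStrongChain ψ ε T a b) : strongChainCost ψ T a b ≤ ε :=
  csInf_le ⟨0, fun _ h => h.pos.le⟩ h

theorem hasStrongChain_of_strongChainCost_lt (h : strongChainCost ψ T a b < ε) :
    HasStrongChain ψ ε T a b := by
  obtain ⟨δ, hδ, hlt⟩ := exists_lt_of_csInf_lt (nonempty_setOf_hasStrongChain ψ T a b) h
  exact HasStrongChain.mono hδ hlt.le

theorem isLyapunov_neg_strongChainCost (hψ : IsFlow ψ) (T : ℝ) (b : X) :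
    IsLyapunov ψ fun a => -strongChainCost ψ T a b := fun s hs a =>
  neg_le_neg <| le_csInf (nonempty_setOf_hasStrongChain ψ T (ψ s a) b) fun _ h =>
    strongChainCost_le (HasStrongChain.of_flow hψ hs h)

theorem lipschitzWith_neg_strongChainCost (hψ : IsFlow ψ) (hT : 0 ≤ T) {C : NNReal}
    (hC : ∀ t ∈ Set.Icc 0 (2 * T), LipschitzWith C (ψ t)) (b : X) :
    LipschitzWith C fun a => -strongChainCost ψ T a b := by
  refine LipschitzWith.of_le_add_mul C fun a a' => ?_
  suffices strongChainCost ψ T a' b - C * dist a a' ≤ strongChainCost ψ T a b by linarith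
  refine le_csInf (nonempty_setOf_hasStrongChain ψ T a b) fun ε h => ?_
  have := strongChainCost_le (h.move_start hψ hT hC a')
  rw [dist_comm a' a] at this
  linarith

end

theorem SCR_of_lipschitz_lyapunov_constant {X : Type*} [MetricSpace X]
    (ψ : ℝ → X → X) (hψ : IsFlow ψ) (hLipFlow : UniformlyLipschitzTimeMaps ψ)
    (hconst : ∀ h : X → ℝ, (∃ K : NNReal, LipschitzWith K h) → IsLyapunov ψ h →
      ∀ x y : X, h x = h y) :
    ∀ x, StronglyChainRecurrentPt ψ x := by
  intro x ε hε T hT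
  obtain ⟨C, hC⟩ := hLipFlow (2 * T) (by linarith)
  have hcost := hconst _ ⟨C, lipschitzWith_neg_strongChainCost hψ hT hC x⟩
    (isLyapunov_neg_strongChainCost hψ T x) x (ψ (-T) x)
  have hback : ψ T (ψ (-T) x) = x := by rw [← hψ.2.2, add_neg_cancel, hψ.2.1]
  have hsmall : strongChainCost ψ T (ψ (-T) x) x ≤ ε / 2 :=
    strongChainCost_le (hasStrongChain_of_dist_lt le_rfl (by rw [hback, dist_self]; linarith))
  refine hasStrongChain_of_strongChainCost_lt ?_
  simp only [neg_inj] at hcost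
  linarith
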